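/- Let w̃ be a minimizer over Ω of w ↦ g(w) − wᵀ A R Rᵀ λ* + γ_w‖w‖₁, where w* ∈ Ω minimizes w ↦ g(w) − wᵀAλ* over Ω (equivalently, there is a gradient/subgradient ∇g(w*) with ⟨∇g(w*) − Aλ*, w − w*⟩ ≥ 0 for all w ∈ Ω). Set ρ_w = ‖A(I − R Rᵀ)λ*‖_∞. If γ_w ≥ 2 ρ_w, then ‖w̃ − w*‖₂ ≤ 3 γ_w √s_w / α, ‖w̃ − w*‖₁ ≤ 12 γ_w s_w / α, and ‖w̃ − w*‖₁ ≤ 4 √s_w · ‖w̃ − w*‖₂. -/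

import Mathlib

open Matrix

/-- Euclidean (ℓ2) norm of a vector. -/
noncomputable def norm2 {k : ℕ} (x : Fin k → ℝ) : ℝ := Real.sqrt (∑ i, (x i) ^ 2)

/-- ℓ1 norm of a vector. -/
noncomputable def norm1 {k : ℕ} (x : Fin k → ℝ) : ℝ := ∑ i, |x i|

/-- ℓ∞ norm of a vector. -/
noncomputable def normInf {k : ℕ} (x : Fin k → ℝ) : ℝ := ⨆ i, |x i|

/-- Number of nonzero entries of a vector. -/
noncomputable def norm0 {k : ℕ} (x : Fin k → ℝ) : ℕ :=
  (Finset.univ.filter fun i => x i ≠ 0).card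

/-- `f` is `μ`-strongly convex with respect to the Euclidean norm. -/
def StronglyConvex {k : ℕ} (μ : ℝ) (f : (Fin k → ℝ) → ℝ) : Prop :=
  ∀ x y : Fin k → ℝ, ∀ t : ℝ, 0 ≤ t → t ≤ 1 →
    f (t • x + (1 - t) • y) ≤
      t * f x + (1 - t) * f y - μ / 2 * (t * (1 - t)) * (norm2 (x - y)) ^ 2

theorem norm2_nonneg {k : ℕ} (x : Fin k → ℝ) : 0 ≤ norm2 x := Real.sqrt_nonneg _

theorem abs_le_normInf {k : ℕ} (x : Fin k → ℝ) (i : Fin k) : |x i| ≤ normInf x :=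
  le_ciSup (f := fun i => |x i|) (Set.finite_range _).bddAbove i

/-- Quadratic growth of a strongly convex function, shifted by a linear form, at a minimizer
over a convex set. -/
theorem StronglyConvex.quadratic_growth {k : ℕ} {μ : ℝ} {f : (Fin k → ℝ) → ℝ}
    (hf : StronglyConvex μ f) {Ω : Set (Fin k → ℝ)} (hΩ : Convex ℝ Ω)
    {x y b : Fin k → ℝ} (hx : x ∈ Ω) (hy : y ∈ Ω)
    (hmin : ∀ w ∈ Ω, f x - x ⬝ᵥ b ≤ f w - w ⬝ᵥ b) :
    f x - x ⬝ᵥ b + μ / 2 * norm2 (y - x) ^ 2 ≤ f y - y ⬝ᵥ b := by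
  set X := μ / 2 * norm2 (y - x) ^ 2 with hX
  set G := (f y - y ⬝ᵥ b) - (f x - x ⬝ᵥ b) with hG
  have hG0 : 0 ≤ G := sub_nonneg.2 (hmin y hy)
  have segment_bound : ∀ t : ℝ, 0 < t → t ≤ 1 → (1 - t) * X ≤ G := by
    intro t ht0 ht1
    have hle := hmin _ (hΩ hy hx ht0.le (sub_nonneg.2 ht1) (by ring))
    have hconv := hf y x t ht0.le ht1
    rw [add_dotProduct, smul_dotProduct, smul_dotProduct, smul_eq_mul, smul_eq_mul] at hle
    refine le_of_mul_le_mul_left ?_ ht0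
    rw [hX, hG]
    linarith
  suffices X ≤ G by linarith
  by_contra! hlt
  have hXpos : 0 < X := hG0.trans_lt hlt
  have hhalf := segment_bound ((X - G) / (2 * X)) (by have := sub_pos.2 hlt; positivity)
    (by rw [div_le_one (by positivity)]; linarith)
  have hmul : (1 - (X - G) / (2 * X)) * X = (X + G) / 2 := by field_simp; ring
  linarith

/-- Cauchy–Schwarz on a set of coordinates. -/
theorem sum_abs_le_sqrt_card_mul_norm2 {k : ℕ} (S : Finset (Fin k)) (x : Fin k → ℝ) :
    ∑ i ∈ S, |x i| ≤ Real.sqrt S.card * norm2 x := by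
  rw [norm2, ← Real.sqrt_mul (Nat.cast_nonneg _)]
  apply Real.le_sqrt_of_sq_le
  calc (∑ i ∈ S, |x i|) ^ 2 ≤ S.card * ∑ i ∈ S, |x i| ^ 2 := sq_sum_le_card_mul_sum_sq
    _ ≤ S.card * ∑ i, x i ^ 2 := by
      simp only [sq_abs]
      gcongr
      exact Finset.subset_univ S

/-- The perturbation and regularization terms are controlled by the support of `x`. -/
theorem neg_dotProduct_add_norm1_sub_le {k : ℕ} {γ : ℝ} (hγ : 0 ≤ γ) (x y e : Fin k → ℝ)
    (he : 2 * normInf e ≤ γ) :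
    -((y - x) ⬝ᵥ e) + γ * (norm1 x - norm1 y) ≤
      γ / 2 * (4 * ∑ i with x i ≠ 0, |(y - x) i| - norm1 (y - x)) := by
  simp only [norm1, dotProduct, Finset.sum_filter, Finset.mul_sum, ← Finset.sum_sub_distrib,
    ← Finset.sum_neg_distrib, ← Finset.sum_add_distrib]
  refine Finset.sum_le_sum fun i _ => ?_
  have hei : |e i| ≤ γ / 2 := by linarith [abs_le_normInf e i]
  have hprod : -((y - x) i * e i) ≤ γ / 2 * |(y - x) i| :=
    calc -((y - x) i * e i) ≤ |(y - x) i * e i| := neg_le_abs _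
      _ = |e i| * |(y - x) i| := by rw [abs_mul, mul_comm]
      _ ≤ γ / 2 * |(y - x) i| := by gcongr
  by_cases hxi : x i = 0
  · simp only [Pi.sub_apply, hxi, sub_zero, abs_zero, ne_eq, not_true_eq_false, if_false] at *
    linarith
  · have htri : |x i| - |y i| ≤ |(y - x) i| := by
      rw [Pi.sub_apply, abs_sub_comm]
      exact abs_sub_abs_le_abs_sub _ _
    have := mul_le_mul_of_nonneg_left htri hγ
    simp only [ne_eq, hxi, not_false_eq_true, if_true]
    linarith

theorem primal_pseudo_solution_bound
    {d n m : ℕ}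
    (A : Matrix (Fin d) (Fin n) ℝ)
    (Ω : Set (Fin d → ℝ))
    (g : (Fin d → ℝ) → ℝ)
    (α γw : ℝ)
    (R : Matrix (Fin n) (Fin m) ℝ)
    (wstar wtil : Fin d → ℝ) (lstar : Fin n → ℝ)
    (hΩ : Convex ℝ Ω)
    (hα : 0 < α) (hγw : 0 < γw)
    (hg : StronglyConvex α g)
    (hwΩ : wstar ∈ Ω) (hwtilΩ : wtil ∈ Ω)
    -- w* minimizes w ↦ g(w) − wᵀAλ* over Ω
    (hwstar : ∀ w ∈ Ω,
      g wstar - wstar ⬝ᵥ (A *ᵥ lstar) ≤ g w - w ⬝ᵥ (A *ᵥ lstar))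
    -- w̃ minimizes w ↦ g(w) − wᵀ A R Rᵀ λ* + γ_w‖w‖₁ over Ω
    (hwtil : ∀ w ∈ Ω,
      g wtil - wtil ⬝ᵥ (A *ᵥ (R *ᵥ (Rᵀ *ᵥ lstar))) + γw * norm1 wtil
        ≤ g w - w ⬝ᵥ (A *ᵥ (R *ᵥ (Rᵀ *ᵥ lstar))) + γw * norm1 w)
    -- γ_w ≥ 2 ρ_w where ρ_w = ‖A(I − R Rᵀ)λ*‖_∞
    (hγ : 2 * normInf (A *ᵥ ((1 - R * Rᵀ) *ᵥ lstar)) ≤ γw) :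
    norm2 (wtil - wstar) ≤ 3 * γw * Real.sqrt (norm0 wstar) / α ∧
    norm1 (wtil - wstar) ≤ 12 * γw * (norm0 wstar : ℝ) / α ∧
    norm1 (wtil - wstar) ≤ 4 * Real.sqrt (norm0 wstar) * norm2 (wtil - wstar) := by
  set D := norm2 (wtil - wstar) with hD
  set s := Real.sqrt (norm0 wstar) with hs
  have hD0 : 0 ≤ D := norm2_nonneg _
  have hs0 : 0 ≤ s := Real.sqrt_nonneg _
  have hss : s * s = norm0 wstar := Real.mul_self_sqrt (Nat.cast_nonneg _)
  have hgrowth := hg.quadratic_growth hΩ hwΩ hwtilΩ hwstar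
  have hopt := hwtil wstar hwΩ
  have hsupp := neg_dotProduct_add_norm1_sub_le hγw.le wstar wtil _ hγ
  have hCS : ∑ i with wstar i ≠ 0, |(wtil - wstar) i| ≤ s * D :=
    sum_abs_le_sqrt_card_mul_norm2 _ _
  have hsplit : A *ᵥ ((1 - R * Rᵀ) *ᵥ lstar)
      = A *ᵥ lstar - A *ᵥ (R *ᵥ (Rᵀ *ᵥ lstar)) := by
    rw [sub_mulVec, one_mulVec, mulVec_sub, ← mulVec_mulVec]
  rw [hsplit, sub_dotProduct, dotProduct_sub, dotProduct_sub] at hsupp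
  rw [← hD] at hgrowth
  set T := ∑ i with wstar i ≠ 0, |(wtil - wstar) i|
  have hbasic : α / 2 * D ^ 2 ≤ γw / 2 * (4 * T - norm1 (wtil - wstar)) := by linarith
  have hcone : norm1 (wtil - wstar) ≤ 4 * T := by
    have : 0 ≤ γw / 2 * (4 * T - norm1 (wtil - wstar)) := le_trans (by positivity) hbasic
    linarith [nonneg_of_mul_nonneg_right this (by positivity)]
  have hT : T ≤ norm1 (wtil - wstar) :=
    Finset.sum_le_sum_of_subset_of_nonneg (Finset.subset_univ _) fun _ _ _ => abs_nonneg _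
  have hl1 : norm1 (wtil - wstar) ≤ 4 * s * D := by linarith
  have hl2 : D ≤ 3 * γw * s / α := by
    rw [le_div_iff₀ hα]
    rcases hD0.eq_or_lt with h0 | hpos
    · rw [← h0, zero_mul]
      positivity
    · refine le_of_mul_le_mul_right ?_ hpos
      have : γw / 2 * (4 * T - norm1 (wtil - wstar)) ≤ γw / 2 * (3 * (s * D)) := by
        gcongr
        linarith
      linarith
  refine ⟨hl2, ?_, hl1⟩
  calc norm1 (wtil - wstar) ≤ 4 * s * D := hl1
    _ ≤ 4 * s * (3 * γw * s / α) := by gcongr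
    _ = 12 * γw * (norm0 wstar : ℝ) / α := by rw [← hss]; ring
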